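/- Let φ : A → B be an étale ring homomorphism, Q a prime ideal of B and P = φ^{-1}(Q). Then for any A_P-module M of finite length, the B_Q-module B_Q ⊗_{A_P} M has the same length as the A_P-module M. -/

import Mathlib

open TensorProduct

/-!
STATEMENT 7. Let `φ : A → B` be an étale ring homomorphism, `Q` a prime of `B` and
`P = φ⁻¹(Q)`.  For any module `M` of finite length over `A_P`, the `B_Q`-module
`B_Q ⊗_{A_P} M` has the same length as `M`.  Since this version of Mathlib has no
`Module.length`, "same length" is expressed via Jordan–Hölder: any composition series
of `M` (from `⊥` to `⊤`) and any composition series of `B_Q ⊗_{A_P} M` have equal length.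
The étale structure and the map `A_P → B_Q` (the induced local homomorphism
`Localization.localRingHom`) are recorded through algebra instances.
-/
universe u
theorem etale_localization_length_eq
    {A B : Type u} [CommRing A] [CommRing B]
    [Algebra A B] [Algebra.Etale A B]
    (φ : A →+* B) (hφ : φ = algebraMap A B)
    (Q : Ideal B) [Q.IsPrime] (P : Ideal A) [P.IsPrime] (hP : P = Q.comap φ)
    [Algebra (Localization.AtPrime P) (Localization.AtPrime Q)]
    (halg : algebraMap (Localization.AtPrime P) (Localization.AtPrime Q)
      = Localization.localRingHom P Q φ hP)
    (M : Type*) [AddCommGroup M] [Module (Localization.AtPrime P) M]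
    (hfl : IsFiniteLength (Localization.AtPrime P) M)
    (s : CompositionSeries (Submodule (Localization.AtPrime P) M))
    (hs : RelSeries.head s = ⊥ ∧ RelSeries.last s = ⊤)
    (t : CompositionSeries (Submodule (Localization.AtPrime Q)
      ((Localization.AtPrime Q) ⊗[Localization.AtPrime P] M)))
    (ht : RelSeries.head t = ⊥ ∧ RelSeries.last t = ⊤) :
    s.length = t.length := by
  subst hφ
  have : Q.LiesOver P := ⟨hP⟩
  have : Localization.AtPrime.IsLiesOverAlgebra P Q := ⟨halg⟩
  have : IsLocalHom (algebraMap (Localization.AtPrime P) (Localization.AtPrime Q)) :=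
    halg ▸ Localization.isLocalHom_localRingHom P Q _ hP
  have : Algebra.EssFiniteType (Localization.AtPrime P) (Localization.AtPrime Q) := .of_comp A _ _
  have : Algebra.FormallyUnramified (Localization.AtPrime P) (Localization.AtPrime Q) :=
    .of_restrictScalars A _ _
  have hres : Module.length (Localization.AtPrime Q) (Localization.AtPrime Q ⧸
      (IsLocalRing.maximalIdeal (Localization.AtPrime P)).map
        (algebraMap (Localization.AtPrime P) (Localization.AtPrime Q))) = 1 := by
    rw [Algebra.FormallyUnramified.map_maximalIdeal, Module.length_eq_one_iff,
      isSimpleModule_iff_isCoatom]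
    exact (IsLocalRing.maximalIdeal.isMaximal _).out
  have hlen := IsLocalRing.length_baseChange (Localization.AtPrime P) (Localization.AtPrime Q) M
  rw [hres, mul_one, ← Module.length_compositionSeries s hs.1 hs.2,
    ← Module.length_compositionSeries t ht.1 ht.2] at hlen
  exact_mod_cast hlen.symm
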